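/- The generalized Poisson pmf Pr(Y = y) = μ(μ + yφ)^{y−1} e^{−(μ + yφ)}/y! with μ > 0 and 0 ≤ φ < 1 sums to 1 over y = 0, 1, 2, …. -/

import Mathlib

/-- The generalized Poisson pmf `Pr(Y = y) = μ(μ + yφ)^{y−1} e^{−(μ + yφ)}/y!`. -/
noncomputable def gpPmf (μ φ : ℝ) (y : ℕ) : ℝ :=
  μ * Real.rpow (μ + (y : ℝ) * φ) ((y : ℝ) - 1) *
    Real.exp (-(μ + (y : ℝ) * φ)) / (Nat.factorial y)

open Finset in
/-- The binomial alternating sum of a power, of exponent less than `n`, of an affine function. -/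
theorem sum_neg_one_pow_choose_mul_affine_pow (μ φ : ℝ) {m n : ℕ} (h : m < n) :
    ∑ k ∈ range (n + 1), (-1 : ℝ) ^ (n - k) * n.choose k * (μ + k * φ) ^ m = 0 := by
  let P : Polynomial ℝ := (Polynomial.C φ * Polynomial.X + Polynomial.C μ) ^ m
  have hP : P.natDegree < n := by
    refine lt_of_le_of_lt (Polynomial.natDegree_pow_le_of_le m
      (Polynomial.natDegree_linear_le (a := φ) (b := μ))) ?_
    simpa using h
  have key := congrFun (Polynomial.fwdDiff_iter_eq_zero_of_degree_lt hP) 0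
  rw [fwdDiff_iter_eq_sum_shift] at key
  rw [← Pi.zero_apply (M := fun _ : ℝ => ℝ) (0 : ℝ), ← key]
  refine sum_congr rfl fun k _ => ?_
  simp [P, zsmul_eq_mul]
  left
  ring

/-- The coefficients `μ(μ + yφ)^{y-1}/y!` of the power series underlying `gpPmf`. -/
noncomputable def gpCoeff (μ φ : ℝ) (y : ℕ) : ℝ :=
  μ * (μ + y * φ) ^ y / (μ + y * φ) / y.factorial

theorem gpCoeff_nonneg {μ φ : ℝ} (hμ : 0 < μ) (hφ : 0 ≤ φ) (y : ℕ) : 0 ≤ gpCoeff μ φ y := by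
  unfold gpCoeff
  positivity

theorem gpCoeff_le {μ φ ρ : ℝ} (hμ : 0 < μ) (hφ : 0 ≤ φ) (hρ : φ < ρ) (y : ℕ) :
    gpCoeff μ φ y ≤ Real.exp (μ / ρ) * (Real.exp 1 * ρ) ^ y := by
  have hρ0 : 0 < ρ := hφ.trans_lt hρ
  have hpos : 0 < μ + y * φ := by positivity
  have hle : μ ≤ μ + y * φ := le_add_of_nonneg_right (by positivity)
  calc gpCoeff μ φ y = μ / (μ + y * φ) * ((μ + y * φ) ^ y / y.factorial) := by
        unfold gpCoeff; ring
    _ ≤ 1 * ((μ + y * φ) ^ y / y.factorial) := by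
        gcongr
        exact (div_le_one hpos).2 hle
    _ ≤ 1 * ((μ + y * ρ) ^ y / y.factorial) := by gcongr
    _ = ρ ^ y * ((μ / ρ + y) ^ y / y.factorial) := by
        rw [one_mul, ← mul_div_assoc, ← mul_pow]
        congr 2
        field_simp
    _ ≤ ρ ^ y * Real.exp (μ / ρ + y) := by
        gcongr
        exact Real.pow_div_factorial_le_exp _ (by positivity) y
    _ = _ := by
        rw [Real.exp_add, mul_pow, ← Real.exp_nat_mul, mul_one]
        ring

theorem analyticAt_tsum_gpCoeff {μ φ ρ z : ℝ} (hμ : 0 < μ) (hφ : 0 ≤ φ) (hρ : φ < ρ)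
    (hz : Real.exp 1 * ρ * |z| < 1) :
    AnalyticAt ℝ (fun x : ℝ => ∑' y, gpCoeff μ φ y * x ^ y) z := by
  have hρ0 : 0 < ρ := hφ.trans_lt hρ
  have hc : 0 < Real.exp 1 * ρ := by positivity
  let p := FormalMultilinearSeries.ofScalars ℝ (gpCoeff μ φ)
  let r : NNReal := ⟨(Real.exp 1 * ρ)⁻¹, by positivity⟩
  have hr : (r : ENNReal) ≤ p.radius := by
    refine p.le_radius_of_bound (Real.exp (μ / ρ)) fun n => ?_
    rw [FormalMultilinearSeries.ofScalars_norm, Real.norm_eq_abs,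
      abs_of_nonneg (gpCoeff_nonneg hμ hφ n)]
    change _ * ((Real.exp 1 * ρ)⁻¹) ^ n ≤ _
    rw [inv_pow, ← div_eq_mul_inv, div_le_iff₀ (by positivity)]
    exact gpCoeff_le hμ hφ hρ n
  have hzr : (‖z‖₊ : ENNReal) < r := by
    rw [ENNReal.coe_lt_coe, ← NNReal.coe_lt_coe]
    change |z| < (Real.exp 1 * ρ)⁻¹
    rwa [← one_div, lt_div_iff₀' hc]
  have hp := p.hasFPowerSeriesOnBall ((zero_le.trans_lt hzr).trans_le hr)
  have hsum : p.sum = fun x : ℝ => ∑' y, gpCoeff μ φ y * x ^ y :=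
    FormalMultilinearSeries.ofScalarsSum_eq_tsum ..
  rw [← hsum]
  refine hp.analyticAt_of_mem ?_
  rw [Metric.mem_eball, edist_zero_right]
  exact hzr.trans_le hr

/-- The terms of the double series obtained by expanding the exponential in the generating function
of `gpPmf`. -/
noncomputable def gpDoubleTerm (μ φ t : ℝ) (p : ℕ × ℕ) : ℝ :=
  gpCoeff μ φ p.1 * t ^ p.1 * ((-(t * (μ + p.1 * φ))) ^ p.2 / p.2.factorial)

theorem sum_antidiagonal_gpDoubleTerm {μ φ : ℝ} (hμ : 0 < μ) (hφ : 0 ≤ φ) (t : ℝ) (n : ℕ) :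
    ∑ p ∈ Finset.HasAntidiagonal.antidiagonal n, gpDoubleTerm μ φ t p = if n = 0 then 1 else 0 := by
  rcases n with _ | m
  · simp [gpDoubleTerm, gpCoeff, hμ.ne']
  rw [Finset.Nat.sum_antidiagonal_eq_sum_range_succ_mk, if_neg (Nat.succ_ne_zero m)]
  rw [← mul_zero (μ * t ^ (m + 1) / (m + 1).factorial),
    ← sum_neg_one_pow_choose_mul_affine_pow μ φ (Nat.lt_succ_self m), Finset.mul_sum]
  refine Finset.sum_congr rfl fun k hk => ?_
  obtain ⟨j, hj⟩ := Nat.exists_eq_add_of_le (Nat.lt_succ_iff.1 (Finset.mem_range.1 hk))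
  have hpos : 0 < μ + k * φ := by positivity
  have hpow : (μ + k * φ) ^ m = (μ + k * φ) ^ k * (μ + k * φ) ^ j / (μ + k * φ) := by
    rw [← pow_add, ← hj, pow_succ, mul_div_cancel_right₀ _ hpos.ne']
  have hfac : ((m + 1).factorial : ℝ) ≠ 0 := by positivity
  rw [Nat.succ_eq_add_one, Nat.cast_choose ℝ (hj ▸ Nat.le_add_right k j), hpow]
  have hsub : m + 1 - k = j := by omega
  have ht : t ^ (m + 1) = t ^ k * t ^ j := by rw [hj, pow_add]
  simp only [gpDoubleTerm, gpCoeff, hsub, ht, neg_pow (t * _), mul_pow]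
  field_simp

theorem hasSum_gpDoubleTerm_snd (μ φ t : ℝ) (y : ℕ) :
    HasSum (fun k => gpDoubleTerm μ φ t (y, k))
      (Real.exp (-(t * μ)) * (gpCoeff μ φ y * (t * Real.exp (-(t * φ))) ^ y)) := by
  have h := (NormedSpace.expSeries_div_hasSum_exp (-(t * (μ + y * φ)))).mul_left
    (gpCoeff μ φ y * t ^ y)
  rw [← Real.exp_eq_exp_ℝ] at h
  convert! h using 1
  rw [mul_pow, ← Real.exp_nat_mul,
    show -(t * (μ + y * φ)) = -(t * μ) + y * -(t * φ) by ring, Real.exp_add]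
  ring

theorem norm_gpDoubleTerm {μ φ : ℝ} (hμ : 0 < μ) (hφ : 0 ≤ φ) (t : ℝ) (y k : ℕ) :
    ‖gpDoubleTerm μ φ t (y, k)‖ =
      gpCoeff μ φ y * |t| ^ y * ((|t| * (μ + y * φ)) ^ k / k.factorial) := by
  have hpos : 0 < μ + y * φ := by positivity
  simp [gpDoubleTerm, abs_of_nonneg (gpCoeff_nonneg hμ hφ y),
    abs_of_pos hpos]

theorem summable_gpDoubleTerm {μ φ ρ t : ℝ} (hμ : 0 < μ) (hφ : 0 ≤ φ) (hρ : φ < ρ)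
    (ht : Real.exp 1 * ρ * (|t| * Real.exp (|t| * φ)) < 1) :
    Summable (gpDoubleTerm μ φ t) := by
  have hρ0 : 0 < ρ := hφ.trans_lt hρ
  have hrow (y : ℕ) : HasSum (fun k => ‖gpDoubleTerm μ φ t (y, k)‖)
      (Real.exp (|t| * μ) * (gpCoeff μ φ y * (|t| * Real.exp (|t| * φ)) ^ y)) := by
    simp_rw [norm_gpDoubleTerm hμ hφ]
    have h := (NormedSpace.expSeries_div_hasSum_exp (|t| * (μ + y * φ))).mul_left
      (gpCoeff μ φ y * |t| ^ y)
    rw [← Real.exp_eq_exp_ℝ] at h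
    convert! h using 1
    rw [mul_pow, ← Real.exp_nat_mul,
      show |t| * (μ + y * φ) = |t| * μ + y * (|t| * φ) by ring, Real.exp_add]
    ring
  refine Summable.of_norm ((summable_prod_of_nonneg fun _ => norm_nonneg _).2
    ⟨fun y => (hrow y).summable, ?_⟩)
  simp_rw [fun y => (hrow y).tsum_eq]
  refine Summable.mul_left _ (Summable.of_nonneg_of_le
    (fun y => mul_nonneg (gpCoeff_nonneg hμ hφ y) (by positivity)) (fun y => ?_)
    ((summable_geometric_of_lt_one (by positivity) ht).mul_left (Real.exp (μ / ρ))))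
  rw [mul_pow (Real.exp 1 * ρ), ← mul_assoc]
  gcongr
  exact gpCoeff_le hμ hφ hρ y

theorem exp_mul_tsum_gpCoeff_of_small {μ φ ρ t : ℝ} (hμ : 0 < μ) (hφ : 0 ≤ φ) (hρ : φ < ρ)
    (ht : Real.exp 1 * ρ * (|t| * Real.exp (|t| * φ)) < 1) :
    Real.exp (-(t * μ)) * ∑' y, gpCoeff μ φ y * (t * Real.exp (-(t * φ))) ^ y = 1 := by
  have hs := summable_gpDoubleTerm hμ hφ hρ ht
  have hrows := hs.tsum_prod' fun y => (hasSum_gpDoubleTerm_snd μ φ t y).summable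
  simp_rw [fun y => (hasSum_gpDoubleTerm_snd μ φ t y).tsum_eq, tsum_mul_left] at hrows
  rw [← hrows, ← Finset.HasAntidiagonal.sigmaAntidiagonalEquivProd.tsum_eq]
  refine ((Finset.HasAntidiagonal.sigmaAntidiagonalEquivProd.summable_iff.2 hs).tsum_sigma'
    fun n => (hasSum_fintype _).summable).trans ?_
  have hdiag (n : ℕ) : ∑' p : Finset.HasAntidiagonal.antidiagonal n, gpDoubleTerm μ φ t
      (Finset.HasAntidiagonal.sigmaAntidiagonalEquivProd ⟨n, p⟩) = if n = 0 then 1 else 0 := by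
    rw [tsum_fintype, ← sum_antidiagonal_gpDoubleTerm hμ hφ t n]
    exact Finset.sum_finset_coe (gpDoubleTerm μ φ t) _
  exact (tsum_congr hdiag).trans (tsum_ite_eq 0 fun _ => (1 : ℝ))

theorem exp_mul_tsum_gpCoeff {μ φ : ℝ} (hμ : 0 < μ) (hφ0 : 0 ≤ φ) (hφ1 : φ < 1) :
    Real.exp (-μ) * ∑' y, gpCoeff μ φ y * Real.exp (-φ) ^ y = 1 := by
  obtain ⟨ρ, hρ, hρ'⟩ : ∃ ρ, φ < ρ ∧ ρ < Real.exp (φ - 1) :=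
    exists_between (by linarith [Real.add_one_lt_exp (sub_ne_zero.2 hφ1.ne)])
  have hρ0 : 0 < ρ := hφ0.trans_lt hρ
  let G : ℝ → ℝ := fun t =>
    Real.exp (-(t * μ)) * ∑' y, gpCoeff μ φ y * (t * Real.exp (-(t * φ))) ^ y
  have hbound {t : ℝ} (ht : t ∈ Set.Icc (0 : ℝ) 1) :
      Real.exp 1 * ρ * |t * Real.exp (-(t * φ))| < 1 := by
    obtain ⟨h0, h1⟩ := ht
    rw [abs_of_nonneg (by positivity)]
    calc Real.exp 1 * ρ * (t * Real.exp (-(t * φ)))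
        ≤ Real.exp 1 * ρ * (Real.exp (t - 1) * Real.exp (-(t * φ))) := by
          gcongr
          linarith [Real.add_one_le_exp (t - 1)]
      _ = ρ * Real.exp (t * (1 - φ)) := by
          rw [mul_right_comm, ← Real.exp_add, ← Real.exp_add, mul_comm]
          congr 2
          ring
      _ < Real.exp (φ - 1) * Real.exp (t * (1 - φ)) := by gcongr
      _ ≤ 1 := by
          rw [← Real.exp_add, Real.exp_le_one_iff]
          nlinarith
  have hG : AnalyticOnNhd ℝ G (Set.Icc 0 1) := fun t ht => by
    refine AnalyticAt.mul (by fun_prop) ?_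
    exact (analyticAt_tsum_gpCoeff hμ hφ0 hρ (hbound ht)).fun_comp
      (f := fun t : ℝ => t * Real.exp (-(t * φ))) (by fun_prop)
  have hnear : G =ᶠ[nhds 0] fun _ => 1 := by
    have hcont : Continuous fun t : ℝ => Real.exp 1 * ρ * (|t| * Real.exp (|t| * φ)) := by
      fun_prop
    filter_upwards [hcont.continuousAt.eventually_lt continuousAt_const
      (show Real.exp 1 * ρ * (|(0 : ℝ)| * Real.exp (|0| * φ)) < 1 by simp)] with t ht
    exact exp_mul_tsum_gpCoeff_of_small hμ hφ0 hρ ht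
  have h := hG.eqOn_of_preconnected_of_eventuallyEq analyticOnNhd_const isPreconnected_Icc
    (Set.left_mem_Icc.2 zero_le_one) hnear (Set.right_mem_Icc.2 zero_le_one)
  simpa [G] using h

theorem gpPmf_eq {μ φ : ℝ} (hμ : 0 < μ) (hφ : 0 ≤ φ) (y : ℕ) :
    gpPmf μ φ y = Real.exp (-μ) * (gpCoeff μ φ y * Real.exp (-φ) ^ y) := by
  have hpos : 0 < μ + y * φ := by positivity
  have hexp : Real.exp (-(μ + y * φ)) = Real.exp (-μ) * Real.exp (-φ) ^ y := by
    rw [← Real.exp_nat_mul, ← Real.exp_add]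
    congr 1
    ring
  rw [gpPmf, Real.rpow_eq_pow, Real.rpow_sub_one hpos.ne', Real.rpow_natCast, hexp, gpCoeff]
  ring

/-- The generalized Poisson pmf with `μ > 0` and `0 ≤ φ < 1` sums to 1. -/
theorem gp_pmf_sums_to_one (μ φ : ℝ) (hμ : 0 < μ) (hφ0 : 0 ≤ φ) (hφ1 : φ < 1) :
    ∑' y : ℕ, gpPmf μ φ y = 1 := by
  simp_rw [gpPmf_eq hμ hφ0, tsum_mul_left]
  exact exp_mul_tsum_gpCoeff hμ hφ0 hφ1
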